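/- Let n ≥ 2 be a natural number, let π be a finite projective plane of order q = (n+1)², and let s, t be natural numbers with q ≥ s > q - n and q ≥ t > q - n. If s ≠ t, then the number of embeddings of K_{s,t} into π equals 2 · C(q²+q+1, 2) · C(q,s) · C(q,t) · s! · t!; if s = t, then the number of embeddings of K_{s,s} into π equals 2 · C(q²+q+1, 2) · C(q,s)² · (s!)². Here C(a,b) denotes the binomial coefficient. -/

import Mathlib

/-- `φ : V → P` is an embedding of the graph `G` into the projective plane with
points `P` and lines `L`. -/
def IsGraphEmbedding {V : Type*} (G : SimpleGraph V) (P L : Type*) [Membership P L]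
    (φ : V → P) : Prop :=
  Function.Injective φ ∧
    ∀ e₁ ∈ G.edgeSet, ∀ e₂ ∈ G.edgeSet, ∀ ℓ : L,
      (∀ v ∈ e₁, φ v ∈ ℓ) → (∀ v ∈ e₂, φ v ∈ ℓ) → e₁ = e₂

open Configuration ProjectivePlane in
/-- The lines through a point `u` avoiding `V`, when no line through `u` meets `V` twice. -/
theorem card_lines_avoiding {P L : Type*} [Fintype P] [Fintype L] [Membership P L]
    [ProjectivePlane P L] [DecidableEq L] {V : Finset P} {u : P} (hu : u ∉ V)
    (hV : ∀ ℓ : L, u ∈ ℓ → ∀ v ∈ V, ∀ w ∈ V, v ∈ ℓ → w ∈ ℓ → v = w)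
    [DecidablePred fun ℓ : L => u ∈ ℓ ∧ ∀ v ∈ V, v ∉ ℓ] :
    (Finset.univ.filter fun ℓ : L => u ∈ ℓ ∧ ∀ v ∈ V, v ∉ ℓ).card + V.card ≤
      order P L + 1 := by
  classical
  have hne : ∀ v ∈ V, u ≠ v := fun v hv h => hu (h ▸ hv)
  have : Nonempty L :=
    ⟨(exists_config (P := P) (L := L)).choose_spec.choose_spec.choose_spec.choose⟩
  choose! join hjoin using fun (v : P) (hv : v ∈ V) =>
    (⟨_, HasLines.mkLine_ax (hne v hv)⟩ : ∃ ℓ : L, u ∈ ℓ ∧ v ∈ ℓ)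
  have hinj : Set.InjOn join V := fun v hv w hw h =>
    hV _ (hjoin v hv).1 v hv w hw (hjoin v hv).2 (h ▸ (hjoin w hw).2)
  rw [← Finset.card_image_of_injOn hinj, ← Finset.card_union_of_disjoint, ← lineCount_eq L u,
    lineCount, Nat.card_eq_fintype_card, Fintype.card_subtype]
  · refine Finset.card_le_card fun ℓ hℓ => ?_
    simp only [Finset.mem_union, Finset.mem_filter, Finset.mem_univ, true_and,
      Finset.mem_image] at hℓ ⊢
    rcases hℓ with h | ⟨v, hv, rfl⟩
    · exact h.1
    · exact (hjoin v hv).1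
  · rw [Finset.disjoint_left]
    intro ℓ hℓ h
    obtain ⟨v, hv, rfl⟩ := Finset.mem_image.1 h
    exact (Finset.mem_filter.1 hℓ).2.2 v hv (hjoin v hv).2

open Configuration ProjectivePlane in
/-- If every line meeting both `U` and `V` meets each of them exactly once, and `U` and `V` are
large enough, then `U` is collinear. -/
theorem exists_line_of_large {P L : Type*} [Fintype P] [Fintype L] [Membership P L]
    [ProjectivePlane P L] {n : ℕ} {U V : Finset P} (hd : Disjoint U V)
    (hU : ∀ ℓ : L, ∀ v ∈ V, v ∈ ℓ → ∀ a ∈ U, ∀ b ∈ U, a ∈ ℓ → b ∈ ℓ → a = b)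
    (hV : ∀ ℓ : L, ∀ u ∈ U, u ∈ ℓ → ∀ a ∈ V, ∀ b ∈ V, a ∈ ℓ → b ∈ ℓ → a = b)
    (hVcard : order P L + 1 ≤ n + V.card) (hUcard : n * (n + 1) + 1 < U.card) :
    ∃ ℓ : L, ∀ u ∈ U, u ∈ ℓ := by
  classical
  let S (u : P) : Finset L := Finset.univ.filter fun ℓ : L => u ∈ ℓ ∧ ∀ v ∈ V, v ∉ ℓ
  have hS : ∀ u ∈ U, (S u).card ≤ n := fun u hu => by
    have := card_lines_avoiding (L := L) (Finset.disjoint_left.1 hd hu) fun ℓ => hV ℓ u hu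
    simp only [S]
    omega
  have : Nonempty L :=
    ⟨(exists_config (P := P) (L := L)).choose_spec.choose_spec.choose_spec.choose⟩
  choose! join hjoin using fun (a b : P) (h : a ≠ b) =>
    (⟨_, HasLines.mkLine_ax h⟩ : ∃ ℓ : L, a ∈ ℓ ∧ b ∈ ℓ)
  have hjS : ∀ a ∈ U, ∀ b ∈ U, a ≠ b → join a b ∈ S a := fun a ha b hb hab => by
    simp only [S, Finset.mem_filter, Finset.mem_univ, true_and]
    exact ⟨(hjoin a b hab).1, fun v hv hvl =>
      hab (hU _ v hv hvl a ha b hb (hjoin a b hab).1 (hjoin a b hab).2)⟩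
  obtain ⟨u, hu⟩ : U.Nonempty := Finset.card_pos.1 (by omega)
  obtain ⟨ℓ, -, hℓ⟩ := Finset.exists_lt_card_fiber_of_mul_lt_card_of_maps_to
    (s := U.erase u) (t := S u) (f := join u) (n := n + 1)
    (fun b hb => hjS u hu b (Finset.mem_of_mem_erase hb) (Finset.ne_of_mem_erase hb).symm)
    (by
      rw [Finset.card_erase_of_mem hu]
      have := Nat.mul_le_mul_right (n + 1) (hS u hu)
      omega)
  refine ⟨ℓ, fun p hp => by_contra fun hpl => ?_⟩
  set W := (U.erase u).filter fun b => join u b = ℓ with hW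
  have hWmem : ∀ b ∈ W, b ∈ U ∧ b ∈ ℓ := fun b hb => by
    rw [hW, Finset.mem_filter, Finset.mem_erase] at hb
    exact ⟨hb.1.2, hb.2 ▸ (hjoin u b (Ne.symm hb.1.1)).2⟩
  have hpne : ∀ b ∈ W, p ≠ b := fun b hb h => hpl (h ▸ (hWmem b hb).2)
  have hle : W.card ≤ (S p).card := by
    refine Finset.card_le_card_of_injOn (join p)
      (fun b hb => hjS p hp b (hWmem b hb).1 (hpne b hb)) fun a ha b hb hab => ?_
    have ha' := hjoin p a (hpne a ha)
    have hb' := hjoin p b (hpne b hb)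
    rw [← hab] at hb'
    refine (Nondegenerate.eq_or_eq ha'.2 hb'.2 (hWmem a ha).2 (hWmem b hb).2).resolve_right
      fun h => hpl (h ▸ ha'.1)
  have := hS p hp
  omega

/-- An embedding of a complete bipartite graph is an injective map for which no line meeting both
classes contains two points of one of them. -/
theorem isGraphEmbedding_completeBipartiteGraph_iff {α β P L : Type*} [Membership P L]
    {φ : α ⊕ β → P} :
    IsGraphEmbedding (completeBipartiteGraph α β) P L φ ↔
      Function.Injective φ ∧
        ∀ (ℓ : L) (a b : α) (c d : β), φ (.inl a) ∈ ℓ → φ (.inl b) ∈ ℓ → φ (.inr c) ∈ ℓ →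
          φ (.inr d) ∈ ℓ → a = b ∧ c = d := by
  refine and_congr_right fun _ => ⟨fun h ℓ a b c d ha hb hc hd => ?_, fun h e he f hf ℓ => ?_⟩
  · have := h s(.inl a, .inr c) (by simp) s(.inl b, .inr d) (by simp) ℓ
      (by simp [ha, hc]) (by simp [hb, hd])
    simpa using this
  · induction e with | _ x y
    induction f with | _ z w
    rcases x with x | x <;> rcases y with y | y <;> rcases z with z | z <;>
      rcases w with w | w <;> simp at he hf ⊢
    · intro h1 h2 h3 h4
      exact h ℓ _ _ _ _ h1 h3 h2 h4
    · intro h1 h2 h3 h4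
      exact h ℓ _ _ _ _ h1 h4 h2 h3
    · intro h1 h2 h3 h4
      exact (h ℓ _ _ _ _ h2 h3 h1 h4).symm
    · intro h1 h2 h3 h4
      exact (h ℓ _ _ _ _ h2 h4 h1 h3).symm

open Configuration ProjectivePlane in
/-- Large complete bipartite graphs embed exactly by putting their classes on two distinct lines,
away from the intersection point. -/
theorem isGraphEmbedding_completeBipartiteGraph_iff_exists_lines {α β P L : Type*}
    [Fintype α] [Fintype β] [Fintype P] [Fintype L] [Membership P L] [ProjectivePlane P L] {n : ℕ}
    (hn : order P L = (n + 1) ^ 2) (hα : order P L + 1 ≤ n + Fintype.card α)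
    (hβ : order P L + 1 ≤ n + Fintype.card β) {φ : α ⊕ β → P} :
    IsGraphEmbedding (completeBipartiteGraph α β) P L φ ↔
      Function.Injective φ ∧ ∃ ℓ m : L, ℓ ≠ m ∧ (∀ a, φ (.inl a) ∈ ℓ ∧ φ (.inl a) ∉ m) ∧
        ∀ b, φ (.inr b) ∈ m ∧ φ (.inr b) ∉ ℓ := by
  classical
  rw [isGraphEmbedding_completeBipartiteGraph_iff]
  refine and_congr_right fun hφ => ⟨fun h => ?_, ?_⟩
  · have hα' : n * (n + 1) + 1 < Fintype.card α := by nlinarith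
    have hβ' : n * (n + 1) + 1 < Fintype.card β := by nlinarith
    let U : Finset P := Finset.univ.image fun a => φ (.inl a)
    let V : Finset P := Finset.univ.image fun b => φ (.inr b)
    have hU : U.card = Fintype.card α :=
      Finset.card_image_of_injective _ (hφ.comp Sum.inl_injective)
    have hV : V.card = Fintype.card β :=
      Finset.card_image_of_injective _ (hφ.comp Sum.inr_injective)
    have hd : Disjoint U V := by
      simp [U, V, Finset.disjoint_left, hφ.eq_iff]
    have h₁ : ∀ ℓ : L, ∀ v ∈ V, v ∈ ℓ → ∀ a ∈ U, ∀ b ∈ U, a ∈ ℓ → b ∈ ℓ → a = b := by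
      simp only [U, V, Finset.forall_mem_image, Finset.mem_univ, true_imp_iff]
      intro ℓ v hv a b ha hb
      rw [(h ℓ a b v v ha hb hv hv).1]
    have h₂ : ∀ ℓ : L, ∀ u ∈ U, u ∈ ℓ → ∀ a ∈ V, ∀ b ∈ V, a ∈ ℓ → b ∈ ℓ → a = b := by
      simp only [U, V, Finset.forall_mem_image, Finset.mem_univ, true_imp_iff]
      intro ℓ u hu a b ha hb
      rw [(h ℓ u u a b hu hu ha hb).2]
    obtain ⟨ℓ, hℓ⟩ := exists_line_of_large (n := n) hd h₁ h₂ (by omega) (by omega)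
    obtain ⟨m, hm⟩ := exists_line_of_large (n := n) hd.symm h₂ h₁ (by omega) (by omega)
    simp only [U, V, Finset.forall_mem_image, Finset.mem_univ, true_imp_iff] at hℓ hm
    obtain ⟨a, a', ha⟩ := Fintype.one_lt_card_iff.1 (by omega : 1 < Fintype.card α)
    obtain ⟨b, b', hb⟩ := Fintype.one_lt_card_iff.1 (by omega : 1 < Fintype.card β)
    have hαm : ∀ x, φ (.inl x) ∉ m := fun x hx => hb (h m x x b b' hx hx (@hm _) (@hm _)).2
    have hβℓ : ∀ x, φ (.inr x) ∉ ℓ := fun x hx => ha (h ℓ a a' x x (@hℓ _) (@hℓ _) hx hx).1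
    exact ⟨ℓ, m, fun e => hαm a (e ▸ @hℓ a), fun x => ⟨@hℓ x, hαm x⟩, fun x => ⟨@hm x, hβℓ x⟩⟩
  · rintro ⟨ℓ, m, -, hℓ, hm⟩ k a b c d ha hb hc hd
    refine ⟨?_, ?_⟩
    · by_contra hab
      have := (Nondegenerate.eq_or_eq ha hb (hℓ a).1 (hℓ b).1).resolve_left
        fun e => hab (Sum.inl_injective (hφ e))
      exact (hm c).2 (this ▸ hc)
    · by_contra hcd
      have := (Nondegenerate.eq_or_eq hc hd (hm c).1 (hm d).1).resolve_left
        fun e => hcd (Sum.inr_injective (hφ e))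
      exact (hℓ a).2 (this ▸ ha)

open Configuration ProjectivePlane in
/-- A line of a plane of order `q` has `q` points off any other line. -/
theorem card_mem_line_not_mem_line {P L : Type*} [Fintype P] [Fintype L] [Membership P L]
    [ProjectivePlane P L] {ℓ m : L} (h : ℓ ≠ m) :
    Nat.card {p : P // p ∈ ℓ ∧ p ∉ m} = order P L := by
  classical
  have hx := HasPoints.mkPoint_ax (P := P) h
  set x : P := HasPoints.mkPoint h
  have hc := pointCount_eq P ℓ
  rw [pointCount, Nat.card_eq_fintype_card, Fintype.card_subtype] at hc
  rw [Nat.card_eq_fintype_card, Fintype.card_subtype]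
  have : (Finset.univ.filter fun p : P => p ∈ ℓ ∧ p ∉ m) =
      (Finset.univ.filter fun p : P => p ∈ ℓ).erase x := by
    ext p
    simp only [Finset.mem_filter, Finset.mem_univ, true_and, Finset.mem_erase]
    refine ⟨fun hp => ⟨fun e => hp.2 (e ▸ hx.2), hp.1⟩, fun hp => ⟨hp.2, fun hpm => ?_⟩⟩
    exact h ((Nondegenerate.eq_or_eq hp.2 hx.1 hpm hx.2).resolve_left hp.1)
  rw [this, Finset.card_erase_of_mem (by simpa using hx.1), hc, Nat.add_sub_cancel]

open Configuration ProjectivePlane in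
/-- The number of embeddings of a large complete bipartite graph, in terms of falling factorials. -/
theorem ncard_embeddings_completeBipartiteGraph {P L : Type*} [Fintype P] [Fintype L]
    [Membership P L] [ProjectivePlane P L] {n s t : ℕ} (hn : order P L = (n + 1) ^ 2)
    (hs : order P L + 1 ≤ n + s) (ht : order P L + 1 ≤ n + t) :
    Set.ncard {φ : Fin s ⊕ Fin t → P |
        IsGraphEmbedding (completeBipartiteGraph (Fin s) (Fin t)) P L φ} =
      2 * (order P L ^ 2 + order P L + 1).choose 2 *
        ((order P L).descFactorial s * (order P L).descFactorial t) := by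
  classical
  let A (ℓ m : L) : Type _ := {p : P // p ∈ ℓ ∧ p ∉ m}
  let X := Σ k : {k : L × L // k.1 ≠ k.2},
    (Fin s ↪ A k.1.1 k.1.2) × (Fin t ↪ A k.1.2 k.1.1)
  let F : X → Fin s ⊕ Fin t → P := fun x =>
    Sum.elim (fun i => (x.2.1 i).1) (fun j => (x.2.2 j).1)
  have hs2 : 1 < s := by nlinarith
  have ht2 : 1 < t := by nlinarith
  have hrange : {φ : Fin s ⊕ Fin t → P |
      IsGraphEmbedding (completeBipartiteGraph (Fin s) (Fin t)) P L φ} = Set.range F := by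
    ext φ
    rw [Set.mem_ofPred_eq, isGraphEmbedding_completeBipartiteGraph_iff_exists_lines hn
      (by simpa using hs) (by simpa using ht)]
    constructor
    · rintro ⟨hφ, ℓ, m, hne, hℓ, hm⟩
      refine ⟨⟨⟨(ℓ, m), hne⟩, ⟨fun i => ⟨φ (.inl i), hℓ i⟩, fun i j h => ?_⟩,
        ⟨fun i => ⟨φ (.inr i), hm i⟩, fun i j h => ?_⟩⟩, ?_⟩
      · exact Sum.inl_injective (hφ (congrArg Subtype.val h))
      · exact Sum.inr_injective (hφ (congrArg Subtype.val h))
      · ext (i | j) <;> rfl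
    · rintro ⟨⟨⟨⟨ℓ, m⟩, hne⟩, f, g⟩, rfl⟩
      refine ⟨Function.Injective.sumElim (Subtype.val_injective.comp f.injective)
        (Subtype.val_injective.comp g.injective) fun i j h => ?_,
        ℓ, m, hne, fun i => (f i).2, fun j => (g j).2⟩
      exact (f i).2.2 (h ▸ (g j).2.1)
  have hinj : Function.Injective F := by
    rintro ⟨⟨⟨ℓ, m⟩, hne⟩, f, g⟩ ⟨⟨⟨ℓ', m'⟩, hne'⟩, f', g'⟩ h
    have hf : ∀ i, (f i).1 = (f' i).1 := fun i => congrFun h (.inl i)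
    have hg : ∀ i, (g i).1 = (g' i).1 := fun i => congrFun h (.inr i)
    obtain rfl : ℓ = ℓ' := by
      refine (Nondegenerate.eq_or_eq (f ⟨0, by omega⟩).2.1 (f ⟨1, hs2⟩).2.1
        (hf _ ▸ (f' ⟨0, by omega⟩).2.1) (hf _ ▸ (f' ⟨1, hs2⟩).2.1)).resolve_left fun e => ?_
      simpa using f.injective (Subtype.ext e)
    obtain rfl : m = m' := by
      refine (Nondegenerate.eq_or_eq (g ⟨0, by omega⟩).2.1 (g ⟨1, ht2⟩).2.1
        (hg _ ▸ (g' ⟨0, by omega⟩).2.1) (hg _ ▸ (g' ⟨1, ht2⟩).2.1)).resolve_left fun e => ?_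
      simpa using g.injective (Subtype.ext e)
    obtain rfl : f = f' := by
      ext i
      exact hf i
    obtain rfl : g = g' := by
      ext i
      exact hg i
    rfl
  have hA : ∀ ℓ m : L, ℓ ≠ m → Fintype.card (A ℓ m) = order P L := fun ℓ m h => by
    rw [← Nat.card_eq_fintype_card]
    exact card_mem_line_not_mem_line h
  have hpairs : Fintype.card {k : L × L // k.1 ≠ k.2} =
      2 * (order P L ^ 2 + order P L + 1).choose 2 := by
    have hoff : (Finset.univ.filter fun k : L × L => k.1 ≠ k.2) = Finset.univ.offDiag := by
      ext
      simp
    rw [Fintype.card_subtype, hoff, Finset.offDiag_card, Finset.card_univ, card_lines P L,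
      Nat.choose_two_right, Nat.mul_div_cancel' (Nat.even_mul_pred_self _).two_dvd,
      Nat.mul_sub_one]
  rw [hrange, Set.ncard_eq_toFinset_card', Set.toFinset_range,
    Finset.card_image_of_injective _ hinj, Finset.card_univ, Fintype.card_sigma, ← hpairs]
  rw [Finset.sum_congr rfl fun k _ => ?_, Finset.sum_const, Finset.card_univ, smul_eq_mul]
  rw [Fintype.card_prod, Fintype.card_embedding_eq, Fintype.card_embedding_eq, hA _ _ k.2,
    hA _ _ k.2.symm, Fintype.card_fin, Fintype.card_fin]

/-- Let `n ≥ 2`, let `π` be a finite projective plane of order `q = (n+1)²`, and let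
`q ≥ s, t > q - n`. If `s ≠ t`, the number of embeddings of `K_{s,t}` into `π` is
`2 · C(q²+q+1, 2) · C(q,s) · C(q,t) · s! · t!`; if `s = t`, the number of embeddings of
`K_{s,s}` into `π` is `2 · C(q²+q+1, 2) · C(q,s)² · (s!)²`. -/
theorem count_Kst_embeddings_special {P L : Type*} [Fintype P] [Fintype L]
    [Membership P L] [Configuration.ProjectivePlane P L] (n q s t : ℕ)
    (hn : 2 ≤ n) (hqn : q = (n + 1) ^ 2)
    (hs₁ : q - n < s) (hs₂ : s ≤ q) (ht₁ : q - n < t) (ht₂ : t ≤ q)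
    (hq : Configuration.ProjectivePlane.order P L = q) :
    (s ≠ t →
      Set.ncard {φ : Fin s ⊕ Fin t → P |
          IsGraphEmbedding (completeBipartiteGraph (Fin s) (Fin t)) P L φ} =
        2 * (q ^ 2 + q + 1).choose 2 * q.choose s * q.choose t *
          s.factorial * t.factorial) ∧
    (s = t →
      Set.ncard {φ : Fin s ⊕ Fin s → P |
          IsGraphEmbedding (completeBipartiteGraph (Fin s) (Fin s)) P L φ} =
        2 * (q ^ 2 + q + 1).choose 2 * q.choose s ^ 2 * s.factorial ^ 2) := by
  refine ⟨fun _ => ?_, ?_⟩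
  · rw [ncard_embeddings_completeBipartiteGraph (L := L) (n := n) (by omega) (by omega) (by omega), hq,
      Nat.descFactorial_eq_factorial_mul_choose, Nat.descFactorial_eq_factorial_mul_choose]
    ring
  · rintro rfl
    rw [ncard_embeddings_completeBipartiteGraph (L := L) (n := n) (by omega) (by omega) (by omega), hq,
      Nat.descFactorial_eq_factorial_mul_choose]
    ring
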